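/- arXiv:1711.09795 — 11 statements merged into one kernel-verified Lean document; each statement's English description precedes it below -/
import Mathlib

section
/- Consider the deterministic multi-strain SIR system. Suppose I_i(t) > 0 for all t ≥ 0 and all strains i. Then for all strains i, j and all t ≥ 0, (1/β_i)·ln(I_i(t)/I_i(0)) + t/R_{0,i} = (1/β_j)·ln(I_j(t)/I_j(0)) + t/R_{0,j}. Equivalently, the quantity (1/β_i)·ln(I_i(t)/I_i(0)) + t/R_{0,i}, which equals ∫_0^t S(u)/N(u) du, is independent of the strain i. -/
open Filter

/-- In the deterministic multi-strain SIR system, if all infected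
compartments stay positive, the quantity `(1/β_i)·ln(I_i(t)/I_i(0)) + t/R_{0,i}`
is independent of the strain `i`, and equals `∫_0^t S(u)/N(u) du`. -/
theorem multi_strain_SIR_strain_invariant
    (d : ℕ) (S N : ℝ → ℝ) (I : Fin d → ℝ → ℝ)
    (lam delta : ℝ) (beta gamma alpha : Fin d → ℝ)
    (hlam : 0 < lam) (hdelta : 0 < delta)
    (hbeta : ∀ i, 0 < beta i) (hgamma : ∀ i, 0 < gamma i) (halpha : ∀ i, 0 ≤ alpha i)
    (hNpos : ∀ t, 0 ≤ t → 0 < N t)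
    (hS : ∀ t, 0 ≤ t →
      HasDerivAt S (lam - ((∑ i, beta i * I i t / N t) + delta) * S t) t)
    (hI : ∀ i, ∀ t, 0 ≤ t →
      HasDerivAt (I i) ((beta i * S t / N t - (delta + alpha i + gamma i)) * I i t) t)
    (hN : ∀ t, 0 ≤ t →
      HasDerivAt N (lam - delta * N t - ∑ i, alpha i * I i t) t)
    (hIpos : ∀ i, ∀ t, 0 ≤ t → 0 < I i t)
    (R0 : Fin d → ℝ) (hR0 : ∀ i, R0 i = beta i / (delta + alpha i + gamma i)) :
    (∀ i j : Fin d, ∀ t, 0 ≤ t →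
      (1 / beta i) * Real.log (I i t / I i 0) + t / R0 i
        = (1 / beta j) * Real.log (I j t / I j 0) + t / R0 j) ∧
    (∀ i : Fin d, ∀ t, 0 ≤ t →
      (1 / beta i) * Real.log (I i t / I i 0) + t / R0 i
        = ∫ u in (0:ℝ)..t, S u / N u) := by
  have key : ∀ i : Fin d, ∀ t, 0 ≤ t →
      (1 / beta i) * Real.log (I i t / I i 0) + t / R0 i
        = ∫ u in (0:ℝ)..t, S u / N u := by
    intro i t ht
    have hb := hbeta i
    have hc : 0 < delta + alpha i + gamma i := by
      have := hgamma i
      have := halpha i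
      linarith
    have hderiv : ∀ u ∈ Set.uIcc 0 t,
        HasDerivAt (fun u => (1 / beta i) * Real.log (I i u / I i 0) + u / R0 i)
          (S u / N u) u := by
      intro u hu
      rw [Set.uIcc_of_le ht] at hu
      have hIu := hIpos i u hu.1
      have hI0 := hIpos i 0 le_rfl
      have hNu := hNpos u hu.1
      have h1 := ((((hI i u hu.1).div_const (I i 0)).log
        (div_pos hIu hI0).ne').const_mul (1 / beta i)).add
        ((hasDerivAt_id u).div_const (R0 i))
      refine h1.congr_deriv ?_
      rw [hR0 i]
      field_simp
      ring
    have hint : IntervalIntegrable (fun u => S u / N u) MeasureTheory.volume 0 t := by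
      apply ContinuousOn.intervalIntegrable
      rw [Set.uIcc_of_le ht]
      intro u hu
      exact ((hS u hu.1).continuousAt.div (hN u hu.1).continuousAt
        (hNpos u hu.1).ne').continuousWithinAt
    rw [intervalIntegral.integral_eq_sub_of_hasDerivAt hderiv hint]
    simp [div_self (hIpos i 0 le_rfl).ne']
  exact ⟨fun i j t ht => (key i t ht).trans (key j t ht).symm, key⟩
end

section
/- Consider the deterministic multi-strain SIR system and suppose that R_{0,1} > R_{0,i} for all strains i ≥ 2 (strong selection). Suppose moreover that I_j(t) > 0 for all t ≥ 0 and all j, and that I_1 is bounded on [0,∞), i.e., there is M > 0 with I_1(t) ≤ M for all t. Then for every strain i ≥ 2 one has the representation I_i(t) = I_i(0)·(I_1(t)/I_1(0))^{β_i/β_1}·exp(−β_i·(R_{0,1} − R_{0,i})/(R_{0,1}·R_{0,i})·t), and consequently I_i(t) → 0 as t → ∞. -/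
open Filter

/-- Strong selection in the deterministic multi-strain SIR system.
If the resident strain `i₀` has the strictly largest `R₀`, all infected
compartments are positive, and `I_{i₀}` is bounded, then every other strain
admits the explicit representation in terms of `I_{i₀}` and tends to `0`. -/
theorem multi_strain_SIR_strong_selection_extinction
    (d : ℕ) (S N : ℝ → ℝ) (I : Fin d → ℝ → ℝ)
    (lam delta : ℝ) (beta gamma alpha : Fin d → ℝ)
    (hlam : 0 < lam) (hdelta : 0 < delta)
    (hbeta : ∀ i, 0 < beta i) (hgamma : ∀ i, 0 < gamma i) (halpha : ∀ i, 0 ≤ alpha i)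
    (hNpos : ∀ t, 0 ≤ t → 0 < N t)
    (hS : ∀ t, 0 ≤ t →
      HasDerivAt S (lam - ((∑ i, beta i * I i t / N t) + delta) * S t) t)
    (hI : ∀ i, ∀ t, 0 ≤ t →
      HasDerivAt (I i) ((beta i * S t / N t - (delta + alpha i + gamma i)) * I i t) t)
    (hN : ∀ t, 0 ≤ t →
      HasDerivAt N (lam - delta * N t - ∑ i, alpha i * I i t) t)
    (hIpos : ∀ i, ∀ t, 0 ≤ t → 0 < I i t)
    (R0 : Fin d → ℝ) (hR0 : ∀ i, R0 i = beta i / (delta + alpha i + gamma i))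
    (i₀ : Fin d) (hsel : ∀ i, i ≠ i₀ → R0 i < R0 i₀)
    (M : ℝ) (hM : 0 < M) (hbound : ∀ t, 0 ≤ t → I i₀ t ≤ M) :
    ∀ i, i ≠ i₀ →
      (∀ t, 0 ≤ t →
        I i t = I i 0 * (I i₀ t / I i₀ 0) ^ (beta i / beta i₀)
          * Real.exp (-(beta i * (R0 i₀ - R0 i) / (R0 i₀ * R0 i)) * t)) ∧
      Tendsto (I i) atTop (nhds 0) := by
  intro i hi
  have hc : ∀ j, 0 < delta + alpha j + gamma j := fun j => by
    have := hgamma j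
    have := halpha j
    linarith
  have hRpos : ∀ j, 0 < R0 j := fun j => by
    rw [hR0 j]
    exact div_pos (hbeta j) (hc j)
  have hkpos : 0 < beta i * (R0 i₀ - R0 i) / (R0 i₀ * R0 i) :=
    div_pos (mul_pos (hbeta i) (sub_pos.2 (hsel i hi))) (mul_pos (hRpos _) (hRpos _))
  have hkeq : beta i * (R0 i₀ - R0 i) / (R0 i₀ * R0 i)
      = (delta + alpha i + gamma i) - beta i / beta i₀ * (delta + alpha i₀ + gamma i₀) := by
    rw [hR0 i, hR0 i₀]
    have h1 := (hbeta i).ne'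
    have h2 := (hbeta i₀).ne'
    have h3 := (hc i).ne'
    have h4 := (hc i₀).ne'
    generalize delta + alpha i + gamma i = a at *
    generalize delta + alpha i₀ + gamma i₀ = b at *
    field_simp
  generalize beta i * (R0 i₀ - R0 i) / (R0 i₀ * R0 i) = k at *
  have hr : 0 < beta i / beta i₀ := div_pos (hbeta i) (hbeta i₀)
  have hG : ∀ t, 0 ≤ t → HasDerivAt
      (fun t => Real.log (I i t) - beta i / beta i₀ * Real.log (I i₀ t) + k * t) 0 t := by
    intro t ht
    have h1 := (hI i t ht).log (hIpos i t ht).ne'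
    have h2 := ((hI i₀ t ht).log (hIpos i₀ t ht).ne').const_mul (beta i / beta i₀)
    have h3 := (hasDerivAt_id t).const_mul k
    refine ((h1.sub h2).add h3).congr_deriv ?_
    rw [mul_div_cancel_right₀ _ (hIpos i t ht).ne', mul_div_cancel_right₀ _ (hIpos i₀ t ht).ne',
      hkeq]
    have := (hbeta i₀).ne'
    have := (hNpos t ht).ne'
    field_simp
    ring
  have hrep : ∀ t, 0 ≤ t →
        I i t = I i 0 * (I i₀ t / I i₀ 0) ^ (beta i / beta i₀) * Real.exp (-k * t) := by
    intro t ht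
    have h := constant_of_has_deriv_right_zero (a := 0) (b := t)
      (fun x hx => (hG x hx.1).continuousAt.continuousWithinAt)
      (fun x hx => (hG x hx.1).hasDerivWithinAt) t ⟨ht, le_rfl⟩
    simp only [mul_zero, add_zero] at h
    have p1 := hIpos i t ht
    have p2 := hIpos i 0 le_rfl
    have p3 := hIpos i₀ t ht
    have p4 := hIpos i₀ 0 le_rfl
    rw [Real.rpow_def_of_pos (div_pos p3 p4), Real.log_div p3.ne' p4.ne']
    conv_lhs => rw [← Real.exp_log p1]
    conv_rhs => rw [← Real.exp_log p2]
    rw [← Real.exp_add, ← Real.exp_add]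
    congr 1
    linarith
  refine ⟨hrep, ?_⟩
  have hlim : Tendsto (fun t => I i 0 * (M / I i₀ 0) ^ (beta i / beta i₀) * Real.exp (-k * t))
      atTop (nhds 0) := by
    have h0 : Tendsto (fun t : ℝ => -k * t) atTop atBot :=
      tendsto_id.const_mul_atTop_of_neg (neg_lt_zero.2 hkpos)
    simpa using (Real.tendsto_exp_atBot.comp h0).const_mul
      (I i 0 * (M / I i₀ 0) ^ (beta i / beta i₀))
  refine tendsto_of_tendsto_of_tendsto_of_le_of_le' tendsto_const_nhds hlim ?_ ?_
  · filter_upwards [eventually_ge_atTop 0] with t ht using (hIpos i t ht).le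
  · filter_upwards [eventually_ge_atTop 0] with t ht
    rw [hrep t ht]
    have p2 := hIpos i 0 le_rfl
    have p3 := hIpos i₀ t ht
    have p4 := hIpos i₀ 0 le_rfl
    have := Real.rpow_le_rpow (div_pos p3 p4).le
      (div_le_div_of_nonneg_right (hbound t ht) p4.le) hr.le
    exact mul_le_mul_of_nonneg_right (mul_le_mul_of_nonneg_left this p2.le) (Real.exp_pos _).le
end

section
/- Consider the deterministic multi-strain SIR system in the weak selection case where two strains i and j have equal basic reproduction numbers, R_{0,i} = R_{0,j}. Suppose I_i(t) > 0 and I_j(t) > 0 for all t ≥ 0. Then for all t ≥ 0, (I_i(t)/I_i(0))^{1/β_i} = (I_j(t)/I_j(0))^{1/β_j}. -/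
open Filter

/-- Weak selection in the deterministic multi-strain SIR system.
If two strains `i`, `j` share the same basic reproduction number and their
infected compartments are positive, then `(I_i(t)/I_i(0))^{1/β_i} =
(I_j(t)/I_j(0))^{1/β_j}` for all `t ≥ 0`. -/
theorem multi_strain_SIR_weak_selection_invariant
    (d : ℕ) (S N : ℝ → ℝ) (I : Fin d → ℝ → ℝ)
    (lam delta : ℝ) (beta gamma alpha : Fin d → ℝ)
    (hlam : 0 < lam) (hdelta : 0 < delta)
    (hbeta : ∀ i, 0 < beta i) (hgamma : ∀ i, 0 < gamma i) (halpha : ∀ i, 0 ≤ alpha i)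
    (hNpos : ∀ t, 0 ≤ t → 0 < N t)
    (hS : ∀ t, 0 ≤ t →
      HasDerivAt S (lam - ((∑ i, beta i * I i t / N t) + delta) * S t) t)
    (hI : ∀ i, ∀ t, 0 ≤ t →
      HasDerivAt (I i) ((beta i * S t / N t - (delta + alpha i + gamma i)) * I i t) t)
    (hN : ∀ t, 0 ≤ t →
      HasDerivAt N (lam - delta * N t - ∑ i, alpha i * I i t) t)
    (R0 : Fin d → ℝ) (hR0 : ∀ i, R0 i = beta i / (delta + alpha i + gamma i))
    (i j : Fin d) (hweak : R0 i = R0 j)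
    (hIi : ∀ t, 0 ≤ t → 0 < I i t) (hIj : ∀ t, 0 ≤ t → 0 < I j t) :
    ∀ t, 0 ≤ t →
      (I i t / I i 0) ^ (1 / beta i) = (I j t / I j 0) ^ (1 / beta j) := by
  intro t ht
  have key : ∀ k, (∀ s, 0 ≤ s → 0 < I k s) → ∀ s, 0 ≤ s →
      HasDerivAt (fun s => Real.log (I k s) / beta k) (S s / N s - 1 / R0 k) s := by
    intro k hk s hs
    have h := ((hI k s hs).log (hk s hs).ne').div_const (beta k)
    refine h.congr_deriv ?_
    rw [hR0 k]
    have h1 := (hk s hs).ne'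
    have h2 := (hbeta k).ne'
    have h3 := (hNpos s hs).ne'
    field_simp
  have hF : ∀ s, 0 ≤ s → HasDerivAt
      (fun s => Real.log (I i s) / beta i - Real.log (I j s) / beta j) 0 s := by
    intro s hs
    have h := (key i hIi s hs).sub (key j hIj s hs)
    rw [hweak, sub_self] at h
    exact h
  have hc := constant_of_has_deriv_right_zero
    (f := fun s => Real.log (I i s) / beta i - Real.log (I j s) / beta j) (a := 0) (b := t)
    (fun s hs => (hF s hs.1).continuousAt.continuousWithinAt)
    (fun s hs => (hF s hs.1).hasDerivWithinAt) t ⟨ht, le_rfl⟩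
  have a0 := hIi 0 le_rfl
  have b0 := hIj 0 le_rfl
  have a1 := hIi t ht
  have b1 := hIj t ht
  rw [Real.rpow_def_of_pos (div_pos a1 a0), Real.rpow_def_of_pos (div_pos b1 b0),
    Real.log_div a1.ne' a0.ne', Real.log_div b1.ne' b0.ne']
  congr 1
  rw [mul_one_div, mul_one_div, sub_div, sub_div]
  linarith
end

section
/- Let λ, δ, γ > 0, α ≥ 0, β > 0 and set R_0 = β/(δ + α + γ). Assume R_0 > 1. Define S* = (λ/(δ R_0))·(1 − α(R_0 − 1)/(β − α)), I* = λ(R_0 − 1)/(β − α), and N* = R_0·S*. Then S*, I*, N* > 0 and (S*, I*, N*) is a fixed point of the single-strain SIR vector field: λ − (β I*/N* + δ)·S* = 0, (β S*/N* − (δ + α + γ))·I* = 0, and λ − δ N* − α I* = 0. -/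
/-- The endemic equilibrium of the single-strain SIR vector field.
If `R₀ > 1`, the point `(S*, I*, N*)` defined by the explicit formulas is
positive and is a fixed point of the single-strain SIR vector field. -/
theorem single_strain_SIR_endemic_equilibrium
    (lam delta gamma alpha beta : ℝ)
    (hlam : 0 < lam) (hdelta : 0 < delta) (hgamma : 0 < gamma)
    (halpha : 0 ≤ alpha) (hbeta : 0 < beta)
    (R0 : ℝ) (hR0def : R0 = beta / (delta + alpha + gamma)) (hR0 : 1 < R0)
    (Sstar Istar Nstar : ℝ)
    (hSdef : Sstar = (lam / (delta * R0)) * (1 - alpha * (R0 - 1) / (beta - alpha)))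
    (hIdef : Istar = lam * (R0 - 1) / (beta - alpha))
    (hNdef : Nstar = R0 * Sstar) :
    0 < Sstar ∧ 0 < Istar ∧ 0 < Nstar ∧
    lam - (beta * Istar / Nstar + delta) * Sstar = 0 ∧
    (beta * Sstar / Nstar - (delta + alpha + gamma)) * Istar = 0 ∧
    lam - delta * Nstar - alpha * Istar = 0 := by
  have hk : 0 < delta + alpha + gamma := by positivity
  have hR : 0 < R0 := by linarith
  have hb : beta = R0 * (delta + alpha + gamma) := by
    rw [hR0def]; field_simp
  have hba : 0 < beta - alpha := by
    rw [hb]; nlinarith [mul_pos (sub_pos.mpr hR0) hk]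
  have hbar : 0 < beta - alpha * R0 := by
    have h : beta - alpha * R0 = R0 * (delta + gamma) := by rw [hb]; ring
    rw [h]; positivity
  have hS : Sstar = lam * (beta - alpha * R0) / (delta * R0 * (beta - alpha)) := by
    rw [hSdef]; field_simp; ring
  have hSpos : 0 < Sstar := by rw [hS]; positivity
  have hIpos : 0 < Istar := by
    rw [hIdef]; exact div_pos (mul_pos hlam (sub_pos.mpr hR0)) hba
  have hNpos : 0 < Nstar := by rw [hNdef]; positivity
  refine ⟨hSpos, hIpos, hNpos, ?_, ?_, ?_⟩
  · have h1 : (beta * Istar / Nstar + delta) * Sstar = beta * Istar / R0 + delta * Sstar := by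
      rw [hNdef]; field_simp
    rw [h1, hS, hIdef]
    field_simp
    ring
  · have h1 : beta * Sstar / Nstar = delta + alpha + gamma := by
      rw [hNdef, hb]; field_simp
    rw [h1]; ring
  · rw [hNdef, hS, hIdef]
    field_simp
    ring
end

section
/- Consider the multi-strain SIR vector field F on ℝ^{d+2} in the weak selection case: there is 1 ≤ m ≤ d and R* > 1 with β_i/(δ + α_i + γ_i) = R* for all i ≤ m. Let x = (x_0, x_1, ..., x_d, x_{d+1}) satisfy: Σ_{i=1}^m (β_i − α_i)·x_i = λ(R* − 1); x_{m+1} = ⋯ = x_d = 0; x_{d+1} = (λ − Σ_{i=1}^m α_i x_i)/δ; x_{d+1} = R*·x_0; and x_{d+1} > 0. Then F(x) = 0, i.e., every point of the set Ω defined by these relations is a fixed point of the deterministic system. -/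
/-- In the weak selection case, every point of the set `Ω`
(defined by the stated relations) is a fixed point of the multi-strain SIR
vector field.  Strains are indexed by `Fin d`, with the first `m` strains
(those with index `< m`) sharing the common reproduction number `R*`. -/
theorem multi_strain_SIR_Omega_fixed_points
    (d m : ℕ) (hm1 : 1 ≤ m) (hmd : m ≤ d)
    (lam delta : ℝ) (beta gamma alpha : Fin d → ℝ)
    (hlam : 0 < lam) (hdelta : 0 < delta)
    (hbeta : ∀ i, 0 < beta i) (hgamma : ∀ i, 0 < gamma i) (halpha : ∀ i, 0 ≤ alpha i)
    (Rstar : ℝ) (hRstar : 1 < Rstar)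
    (hweak : ∀ i : Fin d, (i : ℕ) < m →
      beta i / (delta + alpha i + gamma i) = Rstar)
    (x0 xlast : ℝ) (x : Fin d → ℝ)
    (hsum : ∑ i ∈ Finset.univ.filter (fun i : Fin d => (i : ℕ) < m),
        (beta i - alpha i) * x i = lam * (Rstar - 1))
    (hzero : ∀ i : Fin d, m ≤ (i : ℕ) → x i = 0)
    (hlast : xlast = (lam - ∑ i ∈ Finset.univ.filter (fun i : Fin d => (i : ℕ) < m),
        alpha i * x i) / delta)
    (hx0 : xlast = Rstar * x0)
    (hpos : 0 < xlast) :
    lam - ((∑ i, beta i * x i / xlast) + delta) * x0 = 0 ∧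
    (∀ i : Fin d, (beta i * x0 / xlast - (delta + alpha i + gamma i)) * x i = 0) ∧
    lam - delta * xlast - ∑ i, alpha i * x i = 0 := by
  have key : ∀ c : Fin d → ℝ, ∑ i ∈ Finset.univ.filter (fun i : Fin d => (i : ℕ) < m),
      c i * x i = ∑ i, c i * x i := by
    intro c
    apply Finset.sum_subset (Finset.filter_subset _ _)
    intro i _ hi
    have h : m ≤ (i : ℕ) := by
      by_contra h
      exact hi (by simp; omega)
    rw [hzero i h, mul_zero]
  have hB := (key (fun i => beta i - alpha i)).symm.trans hsum
  simp only [sub_mul, Finset.sum_sub_distrib] at hB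
  rw [key alpha, eq_div_iff hdelta.ne'] at hlast
  have hR : Rstar ≠ 0 := by linarith
  have hx0' : x0 ≠ 0 := by
    rintro rfl
    simp at hx0
    linarith
  refine ⟨?_, ?_, by linarith⟩
  · rw [← Finset.sum_div]
    have e : ((∑ i, beta i * x i) / xlast + delta) * x0
        = (∑ i, beta i * x i + delta * xlast) / Rstar := by
      rw [hx0]
      field_simp
    rw [e, sub_eq_zero, eq_div_iff hR]
    linarith
  · intro i
    by_cases h : (i : ℕ) < m
    · have hp : delta + alpha i + gamma i ≠ 0 := by
        have := hgamma i
        have := halpha i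
        positivity
      have hw := hweak i h
      rw [div_eq_iff hp] at hw
      have e : beta i * x0 / xlast = delta + alpha i + gamma i := by
        rw [hw, hx0]
        field_simp
      rw [e, sub_self, zero_mul]
    · rw [hzero i (by omega), mul_zero]
end

section
/- Consider the multi-strain SIR vector field F on ℝ^{d+2} in the weak selection case: there is 1 ≤ m ≤ d and R* > 1 with β_i/(δ + α_i + γ_i) = R* for all i ≤ m. Let x be a point of the set Ω (so Σ_{i=1}^m (β_i − α_i)x_i = λ(R* − 1), x_{m+1} = ⋯ = x_d = 0, x_{d+1} = (λ − Σ_{i=1}^m α_i x_i)/δ, x_{d+1} = R*·x_0, x_{d+1} > 0). Let u ∈ ℝ^{d+2} be a tangent vector to Ω, i.e., a vector satisfying Σ_{j=1}^m (β_j − α_j)·u_j = 0, u_j = 0 for m < j ≤ d, δ·u_{d+1} + Σ_{j=1}^m α_j u_j = 0, and u_{d+1} = R*·u_0. Then the derivative of F at x annihilates u: (DF)(x)·u = 0. In particular, u is an eigenvector of the Jacobian of F at x with eigenvalue 0. -/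
/-- In the weak selection case, at any point `x ∈ Ω` the Fréchet
derivative of the multi-strain SIR vector field `F` annihilates every vector
`u` tangent to `Ω`; i.e. `u` is an eigenvector of the Jacobian of `F` at `x`
with eigenvalue `0`.  The state space `ℝ^{d+2}` is represented as
`ℝ × (Fin d → ℝ) × ℝ`, with components `(x₀, (x₁,…,x_d), x_{d+1})`. -/
theorem multi_strain_SIR_Omega_tangent_in_kernel
    (d m : ℕ) (hm1 : 1 ≤ m) (hmd : m ≤ d)
    (lam delta : ℝ) (beta gamma alpha : Fin d → ℝ)
    (hlam : 0 < lam) (hdelta : 0 < delta)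
    (hbeta : ∀ i, 0 < beta i) (hgamma : ∀ i, 0 < gamma i) (halpha : ∀ i, 0 ≤ alpha i)
    (Rstar : ℝ) (hRstar : 1 < Rstar)
    (hweak : ∀ i : Fin d, (i : ℕ) < m →
      beta i / (delta + alpha i + gamma i) = Rstar)
    (F : ℝ × (Fin d → ℝ) × ℝ → ℝ × (Fin d → ℝ) × ℝ)
    (hF : ∀ p : ℝ × (Fin d → ℝ) × ℝ,
      F p = (lam - ((∑ i, beta i * p.2.1 i / p.2.2) + delta) * p.1,
             fun i => (beta i * p.1 / p.2.2 - (delta + alpha i + gamma i)) * p.2.1 i,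
             lam - delta * p.2.2 - ∑ i, alpha i * p.2.1 i))
    -- the point x ∈ Ω
    (x0 xlast : ℝ) (x : Fin d → ℝ)
    (hsum : ∑ i ∈ Finset.univ.filter (fun i : Fin d => (i : ℕ) < m),
        (beta i - alpha i) * x i = lam * (Rstar - 1))
    (hzero : ∀ i : Fin d, m ≤ (i : ℕ) → x i = 0)
    (hlast : xlast = (lam - ∑ i ∈ Finset.univ.filter (fun i : Fin d => (i : ℕ) < m),
        alpha i * x i) / delta)
    (hx0 : xlast = Rstar * x0)
    (hpos : 0 < xlast)
    -- the tangent vector u to Ω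
    (u0 ulast : ℝ) (u : Fin d → ℝ)
    (hu1 : ∑ i ∈ Finset.univ.filter (fun i : Fin d => (i : ℕ) < m),
        (beta i - alpha i) * u i = 0)
    (hu2 : ∀ i : Fin d, m ≤ (i : ℕ) → u i = 0)
    (hu3 : delta * ulast + ∑ i ∈ Finset.univ.filter (fun i : Fin d => (i : ℕ) < m),
        alpha i * u i = 0)
    (hu4 : ulast = Rstar * u0) :
    fderiv ℝ F (x0, x, xlast) (u0, u, ulast) = 0 := by
  have hRne : Rstar ≠ 0 := by linarith
  have hfil : ∀ (c y : Fin d → ℝ), (∀ i : Fin d, m ≤ (i : ℕ) → y i = 0) →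
      ∑ i ∈ Finset.univ.filter (fun i : Fin d => (i : ℕ) < m), c i * y i = ∑ i, c i * y i := by
    intro c y hy
    apply Finset.sum_subset (Finset.filter_subset _ _)
    intro i _ hi
    have h : m ≤ (i : ℕ) := by simpa using hi
    rw [hy i h, mul_zero]
  have hsplit : ∀ y : Fin d → ℝ, ∑ i, (beta i - alpha i) * y i
      = ∑ i, beta i * y i - ∑ i, alpha i * y i := by
    intro y
    rw [← Finset.sum_sub_distrib]
    exact Finset.sum_congr rfl fun i _ => by ring
  rw [hfil (fun i => beta i - alpha i) x hzero, hsplit] at hsum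
  rw [hfil alpha x hzero, eq_div_iff hdelta.ne'] at hlast
  rw [hfil (fun i => beta i - alpha i) u hu2, hsplit] at hu1
  rw [hfil alpha u hu2] at hu3
  -- points of Ω are equilibria
  have heq : ∀ (y0 yl : ℝ) (y : Fin d → ℝ),
      ∑ i, beta i * y i - ∑ i, alpha i * y i = lam * (Rstar - 1) →
      (∀ i : Fin d, m ≤ (i : ℕ) → y i = 0) →
      yl * delta = lam - ∑ i, alpha i * y i → yl = Rstar * y0 → yl ≠ 0 →
      F (y0, y, yl) = 0 := by
    intro y0 yl y h1 h2 h3 h4 h5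
    have hy0 : y0 ≠ 0 := by rintro rfl; simp at h4; exact h5 h4
    rw [hF]
    refine Prod.ext ?_ (Prod.ext ?_ ?_)
    · simp only [Prod.fst_zero]
      rw [← Finset.sum_div]
      generalize ∑ i, beta i * y i = B at *
      generalize ∑ i, alpha i * y i = A at *
      subst h4
      field_simp
      linear_combination -h1 - h3
    · funext i
      simp only [Prod.snd_zero, Prod.fst_zero, Pi.zero_apply]
      by_cases hi : (i : ℕ) < m
      · have hs : delta + alpha i + gamma i ≠ 0 := by
          have := hgamma i
          have := halpha i
          positivity
        have hw := hweak i hi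
        rw [div_eq_iff hs] at hw
        rw [h4, hw]
        field_simp
        ring
      · rw [h2 i (not_lt.mp hi), mul_zero]
    · simp only [Prod.snd_zero]
      linear_combination -h3
  have hdiff : DifferentiableAt ℝ F (x0, x, xlast) := by
    have hFe : F = fun p => _ := funext hF
    rw [hFe]
    have hne : ((x0, x, xlast) : ℝ × (Fin d → ℝ) × ℝ).2.2 ≠ 0 := hpos.ne'
    refine DifferentiableAt.prodMk ?_ (DifferentiableAt.prodMk ?_ ?_)
    · fun_prop (disch := exact fun _ => hne)
    · rw [differentiableAt_pi]
      intro i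
      fun_prop (disch := exact hne)
    · fun_prop
  have hl := hdiff.hasFDerivAt.hasLineDerivAt (u0, u, ulast)
  have hev : (fun t : ℝ => F ((x0, x, xlast) + t • (u0, u, ulast))) =ᶠ[nhds 0] fun _ => 0 := by
    have hc : Filter.Tendsto (fun t : ℝ => xlast + t * ulast) (nhds 0) (nhds xlast) := by
      have : Continuous (fun t : ℝ => xlast + t * ulast) := by fun_prop
      simpa using this.tendsto 0
    filter_upwards [hc.eventually_ne hpos.ne'] with t ht
    have hs : ∀ c : Fin d → ℝ, ∑ i, c i * (x + t • u) i
        = ∑ i, c i * x i + t * ∑ i, c i * u i := by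
      intro c
      rw [Finset.mul_sum, ← Finset.sum_add_distrib]
      exact Finset.sum_congr rfl fun i _ => by simp; ring
    refine heq (x0 + t * u0) (xlast + t * ulast) (x + t • u) ?_ ?_ ?_ ?_ ht
    · rw [hs, hs]
      linear_combination hsum + t * hu1
    · intro i hi
      simp [hzero i hi, hu2 i hi]
    · rw [hs]
      linear_combination hlast + t * hu3
    · linear_combination hx0 + t * hu4
  have h0 : HasDerivAt (fun t : ℝ => F ((x0, x, xlast) + t • (u0, u, ulast))) 0 0 :=
    (hasDerivAt_const (0 : ℝ) (0 : ℝ × (Fin d → ℝ) × ℝ)).congr_of_eventuallyEq hev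
  exact HasDerivAt.unique hl h0
end

section
/- (Laplace-type asymptotics at the boundary.) Let a < b be real numbers, let φ : [a,b] → ℝ be continuously differentiable and strictly increasing with φ'(a) > 0, and let g : [a,b] → ℝ be continuous. Then lim_{M → ∞} M·e^{M·φ(a)}·∫_a^b g(x)·e^{−M·φ(x)} dx = g(a)/φ'(a). Equivalently, if g(a) ≠ 0, the ratio of ∫_a^b g(x) e^{−Mφ(x)} dx to (g(a) e^{−Mφ(a)})/(M φ'(a)) tends to 1 as M → ∞. -/
open Filter

/-- Laplace-type asymptotics at the boundary.  If `φ` is `C¹`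
and strictly increasing on `[a,b]` with `φ'(a) > 0` and `g` is continuous,
then `M·e^{Mφ(a)}·∫_a^b g(x) e^{−Mφ(x)} dx → g(a)/φ'(a)` as `M → ∞`. -/
theorem laplace_asymptotics_boundary
    (a b : ℝ) (hab : a < b) (φ φ' g : ℝ → ℝ)
    (hφderiv : ∀ x ∈ Set.Icc a b, HasDerivAt φ (φ' x) x)
    (hφ'cont : ContinuousOn φ' (Set.Icc a b))
    (hmono : StrictMonoOn φ (Set.Icc a b))
    (hφ'a : 0 < φ' a)
    (hg : ContinuousOn g (Set.Icc a b)) :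
    Tendsto
      (fun M : ℝ => M * Real.exp (M * φ a) * ∫ x in a..b, g x * Real.exp (-M * φ x))
      atTop (nhds (g a / φ' a)) := by
  have hacc : a ∈ Set.Icc a b := ⟨le_rfl, hab.le⟩
  have hDa : dslope φ a a = φ' a := by
    rw [dslope_same]; exact (hφderiv a hacc).deriv
  have hDc : ContinuousOn (dslope φ a) (Set.Icc a b) := by
    intro x hx
    apply ContinuousAt.continuousWithinAt
    rcases eq_or_ne x a with h | h
    · subst h
      exact continuousAt_dslope_same.2 (hφderiv x hx).differentiableAt
    · exact (continuousAt_dslope_of_ne h).2 (hφderiv x hx).continuousAt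
  have hsub : ∀ x, (x - a) * dslope φ a x = φ x - φ a := fun x => by
    simpa using sub_smul_dslope φ a x
  have hDpos : ∀ x ∈ Set.Icc a b, 0 < dslope φ a x := by
    intro x hx
    rcases eq_or_lt_of_le hx.1 with h | h
    · rw [← h, hDa]; exact hφ'a
    · have h1 := hmono hacc hx h
      have h2 := hsub x
      have h3 : 0 < (x - a) * dslope φ a x := by linarith
      exact (mul_pos_iff_of_pos_left (by linarith)).1 h3
  generalize dslope φ a = D at *
  obtain ⟨x0, hx0, hmin⟩ := isCompact_Icc.exists_isMinOn ⟨a, hacc⟩ hDc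
  have hc : 0 < D x0 := hDpos x0 hx0
  have hmin' : ∀ x ∈ Set.Icc a b, D x0 ≤ D x := fun x hx => hmin hx
  generalize D x0 = c at *
  obtain ⟨B, hB⟩ := isCompact_Icc.exists_bound_of_continuousOn hg
  have hB0 : 0 ≤ B := (norm_nonneg _).trans (hB a hacc)
  have hmem : ∀ M : ℝ, 0 < M → ∀ t ∈ Set.Ioc 0 (M * (b - a)), a + t / M ∈ Set.Icc a b := by
    intro M hM t ht
    have h1 : 0 < t / M := div_pos ht.1 hM
    have h2 : t / M ≤ b - a := by
      rw [div_le_iff₀ hM]; linarith [ht.2]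
    exact ⟨by linarith, by linarith⟩
  let F : ℝ → ℝ → ℝ := fun M => (Set.Ioc 0 (M * (b - a))).indicator
    (fun t => g (a + t / M) * Real.exp (-t * D (a + t / M)))
  have key : Tendsto (fun M => ∫ t in Set.Ioi (0:ℝ), F M t) atTop
      (nhds (∫ t in Set.Ioi (0:ℝ), g a * Real.exp (-φ' a * t))) := by
    apply MeasureTheory.tendsto_integral_filter_of_dominated_convergence
      (fun t => B * Real.exp (-c * t))
    · filter_upwards [eventually_gt_atTop 0] with M hM
      apply MeasureTheory.AEStronglyMeasurable.restrict
      rw [aestronglyMeasurable_indicator_iff measurableSet_Ioc]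
      apply ContinuousOn.aestronglyMeasurable _ measurableSet_Ioc
      have hm : Set.MapsTo (fun t => a + t / M) (Set.Ioc 0 (M * (b - a))) (Set.Icc a b) :=
        fun t ht => hmem M hM t ht
      have hcont : ContinuousOn (fun t : ℝ => a + t / M) (Set.Ioc 0 (M * (b - a))) := by
        fun_prop
      have h1 := hg.comp hcont hm
      have h2 := hDc.comp hcont hm
      exact h1.mul (Real.continuous_exp.comp_continuousOn (continuousOn_id.neg.mul h2))
    · filter_upwards [eventually_gt_atTop 0] with M hM
      refine Eventually.of_forall fun t => ?_
      by_cases ht : t ∈ Set.Ioc 0 (M * (b - a))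
      · simp only [F, Set.indicator_of_mem ht]
        have hx := hmem M hM t ht
        rw [norm_mul, Real.norm_of_nonneg (Real.exp_pos _).le]
        refine mul_le_mul (hB _ hx) (Real.exp_le_exp.2 ?_) (Real.exp_pos _).le hB0
        nlinarith [hmin' _ hx, ht.1]
      · simp only [F, Set.indicator_of_notMem ht, norm_zero]
        positivity
    · exact (exp_neg_integrableOn_Ioi 0 hc).const_mul B
    · refine (MeasureTheory.ae_restrict_mem measurableSet_Ioi).mono fun t ht => ?_
      have ht0 : 0 < t := ht
      have hev : ∀ᶠ M : ℝ in atTop, 0 < M ∧ t ∈ Set.Ioc 0 (M * (b - a)) := by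
        filter_upwards [eventually_gt_atTop 0, eventually_ge_atTop (t / (b - a))] with M hM hM2
        rw [div_le_iff₀ (by linarith)] at hM2
        exact ⟨hM, ht0, hM2⟩
      have hlim : Tendsto (fun M : ℝ => a + t / M) atTop (nhdsWithin a (Set.Icc a b)) := by
        apply tendsto_nhdsWithin_iff.2 ⟨?_, ?_⟩
        · simpa using (tendsto_const_nhds (x := a)).add
            ((tendsto_const_nhds (x := t)).div_atTop tendsto_id)
        · filter_upwards [hev] with M hM
          exact hmem M hM.1 t hM.2
      have h1 := (hg a hacc).tendsto.comp hlim
      have h2 := (hDc a hacc).tendsto.comp hlim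
      have h3 := h1.mul ((Real.continuous_exp.tendsto _).comp (h2.const_mul (-t)))
      rw [hDa, show -t * φ' a = -φ' a * t by ring] at h3
      refine h3.congr' ?_
      filter_upwards [hev] with M hM
      simp only [F, Set.indicator_of_mem hM.2, Function.comp]
  have hval : ∫ t in Set.Ioi (0:ℝ), g a * Real.exp (-φ' a * t) = g a / φ' a := by
    rw [MeasureTheory.integral_const_mul, integral_exp_mul_Ioi (by linarith)]
    simp [div_eq_mul_inv]
  rw [hval] at key
  refine key.congr' ?_
  filter_upwards [eventually_gt_atTop 0] with M hM
  have hMb : 0 ≤ M * (b - a) := mul_nonneg hM.le (by linarith)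
  simp only [F]
  rw [MeasureTheory.setIntegral_indicator measurableSet_Ioc,
    Set.inter_eq_right.2 Set.Ioc_subset_Ioi_self]
  have h1 := intervalIntegral.integral_comp_add_div (a := 0) (b := M * (b - a))
    (fun x => Real.exp (M * φ a) * (g x * Real.exp (-M * φ x))) hM.ne' a
  rw [show a + 0 / M = a by simp, show a + M * (b - a) / M = b by field_simp; ring,
    smul_eq_mul] at h1
  rw [mul_assoc, ← intervalIntegral.integral_const_mul, ← h1,
    intervalIntegral.integral_of_le hMb]
  refine MeasureTheory.setIntegral_congr_fun measurableSet_Ioc fun t ht => ?_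
  have h2 := hsub (a + t / M)
  have h3 : -t * D (a + t / M) = M * φ a + -M * φ (a + t / M) := by
    have h4 : t * D (a + t / M) = M * ((a + t / M - a) * D (a + t / M)) := by
      field_simp
      ring
    rw [h2] at h4
    linarith
  simp only [h3, Real.exp_add]
  ring
end

section
/- (Laplace-type asymptotics for a shrinking window.) Let a < b be real numbers, let φ : [a,b] → ℝ be continuously differentiable and strictly increasing with φ'(a) > 0, let g : [a,b] → ℝ be continuous, and let X > 0. Then lim_{M → ∞} M·e^{M·φ(a)}·∫_a^{a + X/M} g(x)·e^{−M·φ(x)} dx = (g(a)/φ'(a))·(1 − e^{−φ'(a)·X}). -/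
open Filter

/-- Laplace-type asymptotics for a shrinking window.  Under the
same hypotheses as the boundary case, for `X > 0`,
`M·e^{Mφ(a)}·∫_a^{a+X/M} g(x) e^{−Mφ(x)} dx → (g(a)/φ'(a))·(1 − e^{−φ'(a)X})`
as `M → ∞`. -/
theorem laplace_asymptotics_shrinking_window
    (a b : ℝ) (hab : a < b) (φ φ' g : ℝ → ℝ)
    (hφderiv : ∀ x ∈ Set.Icc a b, HasDerivAt φ (φ' x) x)
    (hφ'cont : ContinuousOn φ' (Set.Icc a b))
    (hmono : StrictMonoOn φ (Set.Icc a b))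
    (hφ'a : 0 < φ' a)
    (hg : ContinuousOn g (Set.Icc a b))
    (X : ℝ) (hX : 0 < X) :
    Tendsto
      (fun M : ℝ =>
        M * Real.exp (M * φ a) * ∫ x in a..(a + X / M), g x * Real.exp (-M * φ x))
      atTop (nhds (g a / φ' a * (1 - Real.exp (-(φ' a) * X)))) := by
  obtain ⟨C, hC⟩ := isCompact_Icc.exists_bound_of_continuousOn hg
  have hφc : ContinuousOn φ (Set.Icc a b) := fun x hx =>
    (hφderiv x hx).continuousAt.continuousWithinAt
  have hinv : Tendsto (fun M : ℝ => M⁻¹) atTop (nhds 0) := tendsto_inv_atTop_zero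
  have hmem : ∀ᶠ M : ℝ in atTop, 0 < M ∧ ∀ t ∈ Set.Icc 0 X, a + t / M ∈ Set.Icc a b := by
    filter_upwards [eventually_gt_atTop 0, eventually_ge_atTop (X / (b - a))] with M h0 hM
    refine ⟨h0, fun t ht => ⟨?_, ?_⟩⟩
    · have := div_nonneg ht.1 h0.le
      linarith
    · have h1 : t / M ≤ b - a := by
        rw [div_le_iff₀ (by linarith)] at hM
        rw [div_le_iff₀ h0]
        linarith [ht.2, mul_comm M (b - a)]
      linarith
  have haI : a ∈ Set.Icc a b := ⟨le_rfl, hab.le⟩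
  have hlim : ∫ t in (0 : ℝ)..X, g a * Real.exp (-(φ' a) * t)
      = g a / φ' a * (1 - Real.exp (-(φ' a) * X)) := by
    rw [intervalIntegral.integral_const_mul,
      intervalIntegral.integral_comp_mul_left (fun x => Real.exp x) (neg_ne_zero.2 hφ'a.ne'),
      integral_exp]
    simp only [mul_zero, Real.exp_zero, smul_eq_mul]
    field_simp
    ring
  have key : Tendsto (fun M : ℝ => ∫ t in (0 : ℝ)..X,
      g (a + t / M) * Real.exp (-M * (φ (a + t / M) - φ a))) atTop
      (nhds (∫ t in (0 : ℝ)..X, g a * Real.exp (-(φ' a) * t))) := by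
    apply intervalIntegral.tendsto_integral_filter_of_dominated_convergence (fun _ => C)
    · filter_upwards [hmem] with M hM
      rw [Set.uIoc_of_le hX.le]
      refine (ContinuousOn.mono ?_ Set.Ioc_subset_Icc_self).aestronglyMeasurable
        measurableSet_Ioc (s := Set.Ioc 0 X)
      have hl : ContinuousOn (fun t : ℝ => a + t / M) (Set.Icc 0 X) := by fun_prop
      have h1 := hg.comp hl hM.2
      have h2 := hφc.comp hl hM.2
      exact h1.mul (Real.continuous_exp.comp_continuousOn
        (continuousOn_const.mul (h2.sub continuousOn_const)))
    · filter_upwards [hmem] with M hM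
      refine Eventually.of_forall fun t ht => ?_
      rw [Set.uIoc_of_le hX.le] at ht
      have hm := hM.2 t (Set.Ioc_subset_Icc_self ht)
      have h1 := hC _ hm
      have h2 : φ a ≤ φ (a + t / M) := hmono.monotoneOn haI hm hm.1
      have h3 : Real.exp (-M * (φ (a + t / M) - φ a)) ≤ 1 := by
        rw [Real.exp_le_one_iff]
        nlinarith [hM.1, mul_nonneg hM.1.le (sub_nonneg.2 h2)]
      rw [norm_mul, Real.norm_of_nonneg (Real.exp_pos _).le]
      calc _ ≤ ‖g (a + t / M)‖ * 1 := by gcongr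
        _ ≤ C := by simpa using h1
    · exact intervalIntegrable_const
    · refine Eventually.of_forall fun t ht => ?_
      rw [Set.uIoc_of_le hX.le] at ht
      have hx : Tendsto (fun M : ℝ => a + t / M) atTop (nhds a) := by
        simpa [div_eq_mul_inv] using (hinv.const_mul t).const_add a
      have hxw : Tendsto (fun M : ℝ => a + t / M) atTop (nhdsWithin a (Set.Icc a b)) := by
        refine tendsto_nhdsWithin_iff.2 ⟨hx, ?_⟩
        filter_upwards [hmem] with M hM using hM.2 t (Set.Ioc_subset_Icc_self ht)
      have hgl := (hg a haI).tendsto.comp hxw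
      have hd : HasDerivAt (fun s : ℝ => φ (a + s * t)) (φ' a * t) 0 := by
        have h1 : HasDerivAt (fun s : ℝ => a + s * t) t 0 := by
          simpa using ((hasDerivAt_id (0 : ℝ)).mul_const t).const_add a
        have h2 : HasDerivAt φ (φ' a) (a + 0 * t) := by simpa using hφderiv a haI
        exact h2.comp (0 : ℝ) h1
      have hs := hasDerivAt_iff_tendsto_slope_zero.1 hd
      have hiw : Tendsto (fun M : ℝ => M⁻¹) atTop (nhdsWithin 0 {0}ᶜ) := by
        refine tendsto_nhdsWithin_iff.2 ⟨hinv, ?_⟩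
        filter_upwards [eventually_gt_atTop 0] with M h0
        simpa using h0.ne'
      have hs2 := (hs.comp hiw).neg
      refine hgl.mul ((Real.continuous_exp.tendsto _).comp ?_)
      rw [neg_mul]
      refine hs2.congr fun M => ?_
      simp [div_eq_mul_inv, mul_comm]
  rw [hlim] at key
  refine key.congr' ?_
  filter_upwards [hmem] with M hM
  have h := intervalIntegral.integral_comp_add_div (a := 0) (b := X)
    (fun x => g x * Real.exp (-M * (φ x - φ a))) hM.1.ne' a
  rw [h, smul_eq_mul, zero_div, add_zero, mul_assoc, ← intervalIntegral.integral_const_mul (Real.exp (M * φ a))]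
  congr 1
  refine intervalIntegral.integral_congr fun x _ => ?_
  rw [show -M * (φ x - φ a) = M * φ a + -M * φ x by ring, Real.exp_add]
  ring
end

section
/- (Stationary distribution for a flat fitness landscape.) Let δ, γ > 0 and 0 ≤ α_min < α_max. Define ψ(α) = [ln((δ + α_max + γ)/(δ + α_min + γ))]^{−1} · 1/(δ + α + γ) on [α_min, α_max]. Then (i) ψ ≥ 0 and ∫_{α_min}^{α_max} ψ(α) dα = 1, so ψ is a probability density on [α_min, α_max]; and (ii) for any constant c > 0, with drift μ(α) = −(c/2)·1/(δ + α + γ) and constant diffusion coefficient σ²(α) ≡ c, ψ satisfies the stationary equation −(μψ)'(α) + (c/2)·ψ''(α) = 0 on (α_min, α_max). -/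
/-- Stationary distribution for a flat fitness landscape.
The function `ψ(α) = [ln((δ+α_max+γ)/(δ+α_min+γ))]⁻¹ · 1/(δ+α+γ)` is a
probability density on `[α_min, α_max]`, and for any `c > 0` it solves the
stationary equation `−(μψ)' + (c/2)ψ'' = 0` with drift
`μ(α) = −(c/2)/(δ+α+γ)` and constant diffusion coefficient `c`. -/
theorem flat_fitness_landscape_stationary_distribution
    (delta gamma : ℝ) (hdelta : 0 < delta) (hgamma : 0 < gamma)
    (amin amax : ℝ) (hamin : 0 ≤ amin) (hlt : amin < amax)
    (ψ : ℝ → ℝ)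
    (hψ : ∀ α, ψ α = (Real.log ((delta + amax + gamma) / (delta + amin + gamma)))⁻¹
        * (1 / (delta + α + gamma))) :
    (∀ α ∈ Set.Icc amin amax, 0 ≤ ψ α) ∧
    (∫ α in amin..amax, ψ α) = 1 ∧
    (∀ c : ℝ, 0 < c → ∀ α ∈ Set.Ioo amin amax,
      -(deriv (fun x => (-(c / 2) * (1 / (delta + x + gamma))) * ψ x) α)
        + (c / 2) * deriv (deriv ψ) α = 0) := by
  have h0 : 0 < delta + amin + gamma := by linarith
  have h1 : 0 < delta + amax + gamma := by linarith
  have hL : 0 < Real.log ((delta + amax + gamma) / (delta + amin + gamma)) := by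
    apply Real.log_pos
    rw [one_lt_div h0]
    linarith
  have hfun : ψ = fun α => (Real.log ((delta + amax + gamma) / (delta + amin + gamma)))⁻¹
        * (α + (delta + gamma))⁻¹ := by
    funext α
    rw [hψ, one_div]
    congr 2
    ring
  refine ⟨?_, ?_, ?_⟩
  · intro α hα
    have := hα.1
    have h2 : 0 < delta + α + gamma := by linarith
    rw [hψ]
    positivity
  · rw [hfun, intervalIntegral.integral_const_mul,
      intervalIntegral.integral_comp_add_right (fun x => x⁻¹),
      integral_inv_of_pos (by linarith) (by linarith)]
    have e : (amax + (delta + gamma)) / (amin + (delta + gamma))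
        = (delta + amax + gamma) / (delta + amin + gamma) := by
      congr 1 <;> ring
    rw [e]
    exact inv_mul_cancel₀ hL.ne'
  · intro c _ α _
    have hd : deriv ψ = fun x =>
        (Real.log ((delta + amax + gamma) / (delta + amin + gamma)))⁻¹
          * (-((x + (delta + gamma)) ^ 2)⁻¹) := by
      funext x
      rw [hfun, deriv_const_mul_field, deriv_comp_add_const (fun y : ℝ => y⁻¹), deriv_inv]
    have hm : (fun x => (-(c / 2) * (1 / (delta + x + gamma))) * ψ x)
        = fun x => (c / 2) * deriv ψ x := by
      funext x
      rw [hd, hψ, show delta + x + gamma = x + (delta + gamma) by ring, one_div]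
      beta_reduce
      rw [← inv_pow]
      generalize (x + (delta + gamma))⁻¹ = u
      generalize (Real.log _)⁻¹ = K
      ring
    rw [hm, deriv_const_mul_field]
    ring
end

section
/- (Mode condition for the stationary virulence distribution.) Let δ, γ > 0, let β be a differentiable positive function of the virulence α, and set R_0(α) = β(α)/(δ + α + γ). Let N > 1 be a real number (representing the equilibrium pathogen population size n·I_eq(α)). Then the drift condition N·R_0'(α)/R_0(α) − β'(α)/β(α) = 0 holds if and only if β'(α) = R_0(α)·(1 + 1/(N − 1)). In particular, as N → ∞ this condition recovers the marginal value theorem β'(α) = R_0(α). -/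
open Filter

/-- Mode condition for the stationary virulence distribution.
With `R₀(α) = β(α)/(δ+α+γ)` and equilibrium pathogen population size `N > 1`,
the drift vanishes, `N·R₀'(α)/R₀(α) − β'(α)/β(α) = 0`, iff
`β'(α) = R₀(α)·(1 + 1/(N−1))`; as `N → ∞` this recovers the marginal value
theorem `β'(α) = R₀(α)`. -/
theorem stationary_virulence_mode_condition
    (delta gamma : ℝ) (hdelta : 0 < delta) (hgamma : 0 < gamma)
    (beta : ℝ → ℝ) (α : ℝ) (hα : 0 ≤ α)
    (hdiff : DifferentiableAt ℝ beta α) (hbpos : 0 < beta α)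
    (R0 : ℝ → ℝ) (hR0 : ∀ x, R0 x = beta x / (delta + x + gamma))
    (N : ℝ) (hN : 1 < N) :
    (N * deriv R0 α / R0 α - deriv beta α / beta α = 0 ↔
      deriv beta α = R0 α * (1 + 1 / (N - 1))) ∧
    Tendsto (fun M : ℝ => R0 α * (1 + 1 / (M - 1))) atTop (nhds (R0 α)) := by
  have hs : 0 < delta + α + gamma := by linarith
  have hN1 : 0 < N - 1 := by linarith
  constructor
  · have hd : HasDerivAt R0 ((deriv beta α * (delta + α + gamma) - beta α * 1)
        / (delta + α + gamma) ^ 2) α := by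
      have h1 : HasDerivAt (fun x : ℝ => delta + x + gamma) 1 α :=
        ((hasDerivAt_id α).const_add delta).add_const gamma
      have h2 : R0 = fun x => beta x / (delta + x + gamma) := funext hR0
      rw [h2]
      exact hdiff.hasDerivAt.fun_div h1 hs.ne'
    rw [hd.deriv, hR0 α]
    generalize deriv beta α = d
    generalize beta α = b at *
    generalize delta + α + gamma = s at *
    have key : N * ((d * s - b * 1) / s ^ 2) / (b / s) - d / b
        = (N - 1) / b * (d - b / s * (1 + 1 / (N - 1))) := by
      have := hN1.ne'
      have := hs.ne'
      have := hbpos.ne'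
      field_simp
      ring
    rw [key, mul_eq_zero, sub_eq_zero]
    exact or_iff_right (div_pos hN1 hbpos).ne'
  · have h1 : Tendsto (fun M : ℝ => M - 1) atTop atTop := by
      simpa [sub_eq_add_neg] using tendsto_atTop_add_const_right atTop (-1 : ℝ) tendsto_id
    have h2 := ((tendsto_inv_atTop_zero.comp h1).const_add (1 : ℝ)).const_mul (R0 α)
    simpa [Function.comp_def] using h2
end

section
/- (The stochastic mode lies below the deterministic optimum.) Let δ, γ > 0, and let β be a differentiable function on an interval (α_min, α_max) with β(α) > 0 and β'(α) > 0 for all α. Set R_0(α) = β(α)/(δ + α + γ), and suppose R_0 attains a unique maximum at α_0 ∈ (α_min, α_max) with R_0'(α) > 0 for α < α_0 and R_0'(α) < 0 for α > α_0. Suppose α* ∈ (α_min, α_max) satisfies N·R_0'(α*)/R_0(α*) = β'(α*)/β(α*) for some real N > 0. Then R_0'(α*) > 0, and consequently α* < α_0. -/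
/-- The stochastic mode lies below the deterministic optimum.
If `β > 0` and `β' > 0` on the interval, `R₀` has a unique maximum at `α₀`
with `R₀' > 0` left of `α₀` and `R₀' < 0` right of it, and `α*` satisfies the
mode condition `N·R₀'(α*)/R₀(α*) = β'(α*)/β(α*)` for some `N > 0`, then
`R₀'(α*) > 0` and hence `α* < α₀`. -/
theorem stochastic_mode_below_deterministic_optimum
    (delta gamma : ℝ) (hdelta : 0 < delta) (hgamma : 0 < gamma)
    (amin amax : ℝ) (hamin : 0 ≤ amin)
    (beta : ℝ → ℝ)
    (hdiff : ∀ α ∈ Set.Ioo amin amax, DifferentiableAt ℝ beta α)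
    (hbpos : ∀ α ∈ Set.Ioo amin amax, 0 < beta α)
    (hb'pos : ∀ α ∈ Set.Ioo amin amax, 0 < deriv beta α)
    (R0 : ℝ → ℝ) (hR0 : ∀ x, R0 x = beta x / (delta + x + gamma))
    (α0 : ℝ) (hα0 : α0 ∈ Set.Ioo amin amax)
    (hmax : ∀ α ∈ Set.Ioo amin amax, α ≠ α0 → R0 α < R0 α0)
    (hup : ∀ α ∈ Set.Ioo amin amax, α < α0 → 0 < deriv R0 α)
    (hdown : ∀ α ∈ Set.Ioo amin amax, α0 < α → deriv R0 α < 0)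
    (αs : ℝ) (hαs : αs ∈ Set.Ioo amin amax)
    (N : ℝ) (hN : 0 < N)
    (hcond : N * deriv R0 αs / R0 αs = deriv beta αs / beta αs) :
    0 < deriv R0 αs ∧ αs < α0 := by
  have hRpos : 0 < R0 αs := by
    rw [hR0]
    have h1 := hαs.1
    exact div_pos (hbpos αs hαs) (by linarith)
  have hpos : 0 < N * deriv R0 αs / R0 αs := by
    rw [hcond]
    exact div_pos (hb'pos αs hαs) (hbpos αs hαs)
  have hder : 0 < deriv R0 αs :=
    (mul_pos_iff_of_pos_left hN).1 ((div_pos_iff_of_pos_right hRpos).1 hpos)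
  refine ⟨hder, ?_⟩
  rcases lt_trichotomy αs α0 with h | h | h
  · exact h
  · exfalso
    have hloc : IsLocalMax R0 α0 := by
      filter_upwards [Ioo_mem_nhds hα0.1 hα0.2] with x hx
      by_cases hx0 : x = α0
      · rw [hx0]
      · exact (hmax x hx hx0).le
    have h0 := hloc.deriv_eq_zero
    rw [h, h0] at hder
    exact lt_irrefl _ hder
  · exact absurd hder (not_lt.2 (hdown αs hαs h).le)
end
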